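/- Let p > 1 and let j, k be integers with 0 ≤ j ≤ k. Then the identity ∑_{i=0}^{j} C(k-j+i, i) ∏_{r=1}^{i} [(j+1-r+ℰ_{j-r}(p-2))(k-j+2r+𝒪_{k+j-1})] / [(k+1+r+ℰ_{k+r-1}(p-2))(k-j+2r-𝒪_{k+j-1})] = ∏_{r=0}^{k-j} (k+1-r+𝒪_{k-r}(p-2)) / (r+1+𝒪_r(p-2+2j)) holds, where ℰ_m = 1 if m is even (0 otherwise), 𝒪_m = 1 if m is odd (0 otherwise), and C(n,i) is the binomial coefficient. -/

import Mathlib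

open Finset

noncomputable section

/-- 𝒪ₘ = 1 if m is odd, 0 otherwise. -/
def Opar (m : ℤ) : ℝ := if Odd m then 1 else 0

/-- ℰₘ = 1 if m is even, 0 otherwise. -/
def Epar (m : ℤ) : ℝ := if Even m then 1 else 0

theorem Opar_zero {m : ℤ} (h : m % 2 = 0) : Opar m = 0 := by
  unfold Opar; rw [if_neg]; rw [Int.odd_iff]; omega

theorem Opar_one {m : ℤ} (h : m % 2 = 1) : Opar m = 1 := by
  unfold Opar; rw [if_pos]; rwa [Int.odd_iff]

theorem Epar_eq (m : ℤ) : Epar m = Opar (m + 1) := by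
  unfold Epar Opar
  have : Even m ↔ Odd (m + 1) := by rw [Int.even_iff, Int.odd_iff]; omega
  simp only [this]

theorem Opar_congr {m n : ℤ} (h : m % 2 = n % 2) : Opar m = Opar n := by
  unfold Opar
  have : Odd m ↔ Odd n := by rw [Int.odd_iff, Int.odd_iff]; omega
  simp only [this]

/-- Numbers shifted at odd arguments. -/
def aa (p : ℝ) (m : ℤ) : ℝ := m + Opar m * (p - 2)
/-- Numbers shifted at even arguments. -/
def bb (p : ℝ) (m : ℤ) : ℝ := m + Opar (m + 1) * (p - 2)

theorem bb_pos (p : ℝ) (hp : 1 < p) (m : ℤ) (hm : 1 ≤ m) : 0 < bb p m := by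
  have h1 : (1 : ℝ) ≤ m := by exact_mod_cast hm
  unfold bb
  rcases Int.emod_two_eq_zero_or_one m with h | h
  · rw [Opar_one (by omega)]; linarith
  · rw [Opar_zero (by omega)]; linarith

theorem aa_even (p : ℝ) {m : ℤ} (h : m % 2 = 0) : aa p m = m := by
  unfold aa; rw [Opar_zero h]; ring
theorem aa_odd (p : ℝ) {m : ℤ} (h : m % 2 = 1) : aa p m = m + p - 2 := by
  unfold aa; rw [Opar_one h]; ring
theorem bb_even (p : ℝ) {m : ℤ} (h : m % 2 = 0) : bb p m = m + p - 2 := by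
  unfold bb; rw [Opar_one (by omega)]; ring
theorem bb_odd (p : ℝ) {m : ℤ} (h : m % 2 = 1) : bb p m = m := by
  unfold bb; rw [Opar_zero (by omega)]; ring

/-- The product in the summand. -/
def PP (p : ℝ) (j d i : ℕ) : ℝ :=
  ∏ r ∈ Finset.range i, aa p ((j : ℤ) - r) / bb p ((j : ℤ) + d + 2 + r)

/-- The summand for odd difference. -/
def FF (p : ℝ) (j d i : ℕ) : ℝ := (Nat.choose (d + i) i : ℝ) * PP p j d i

/-- Right-hand side numerator. -/
def NN (p : ℝ) (j d : ℕ) : ℝ := ∏ r ∈ Finset.range (d + 1), bb p ((j : ℤ) + 1 + r)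

/-- Right-hand side denominator. -/
def DD (p : ℝ) (j d : ℕ) : ℝ :=
  ∏ r ∈ Finset.range (d + 1), ((r : ℝ) + 1 + Opar (r : ℤ) * (p - 2 + 2 * j))

theorem DD_pos (p : ℝ) (hp : 1 < p) (j d : ℕ) : 0 < DD p j d := by
  unfold DD
  apply Finset.prod_pos
  intro r _
  have hj : (0 : ℝ) ≤ j := Nat.cast_nonneg j
  have hr : (0 : ℝ) ≤ r := Nat.cast_nonneg r
  rcases Int.emod_two_eq_zero_or_one (r : ℤ) with h | h
  · rw [Opar_zero h]; linarith
  · rw [Opar_one h]; linarith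

theorem choose_step (d t : ℕ) :
    (Nat.choose (d + (t + 1)) (t + 1) : ℝ) = Nat.choose (d + t) t * (d + t + 1) / (t + 1) := by
  have h := Nat.add_one_mul_choose_eq (d + t) t
  have h' : ((d : ℝ) + t + 1) * (Nat.choose (d + t) t : ℝ)
      = (Nat.choose (d + (t + 1)) (t + 1) : ℝ) * (t + 1) := by exact_mod_cast h
  rw [eq_div_iff (by positivity)]
  linarith

theorem PP_succ (p : ℝ) (j d t : ℕ) :
    PP p j d (t + 1) = PP p j d t * (aa p ((j : ℤ) - t) / bb p ((j : ℤ) + d + 2 + t)) := by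
  unfold PP; rw [Finset.prod_range_succ]

theorem PP_shift (p : ℝ) (hp : 1 < p) (j d t : ℕ) :
    PP p (j + 1) d (t + 1) = PP p j d t * (aa p ((j : ℤ) + 1) * bb p ((j : ℤ) + d + 2)
      / (bb p ((j : ℤ) + d + 2 + t) * bb p ((j : ℤ) + d + 3 + t))) := by
  have hb : ∀ m : ℤ, 1 ≤ m → bb p m ≠ 0 := fun m hm => (bb_pos p hp m hm).ne'
  induction t with
  | zero =>
    have h1 := hb ((j : ℤ) + d + 2) (by omega)
    have h3 : ((j + 1 : ℕ) : ℤ) + d + 2 + (0 : ℕ) = (j : ℤ) + d + 3 := by push_cast; ring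
    have h4 : ((j + 1 : ℕ) : ℤ) - (0 : ℕ) = (j : ℤ) + 1 := by push_cast; ring
    rw [PP_succ, h3, h4]
    simp only [PP, Finset.range_zero, Finset.prod_empty, Nat.cast_zero, add_zero, one_mul]
    have h2 := hb ((j : ℤ) + d + 3) (by omega)
    field_simp
  | succ t ih =>
    have h1 := hb ((j : ℤ) + d + 2 + t) (by omega)
    have h2 := hb ((j : ℤ) + d + 3 + t) (by omega)
    have h5 := hb ((j : ℤ) + d + 4 + t) (by omega)
    rw [PP_succ, ih, PP_succ p j d t]
    have e1 : ((j + 1 : ℕ) : ℤ) + d + 2 + (t + 1 : ℕ) = (j : ℤ) + d + 4 + t := by push_cast; ring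
    have e2 : ((j + 1 : ℕ) : ℤ) - (t + 1 : ℕ) = (j : ℤ) - t := by push_cast; ring
    have e3 : (j : ℤ) + d + 2 + (t + 1 : ℕ) = (j : ℤ) + d + 3 + t := by push_cast; ring
    have e4 : (j : ℤ) + d + 3 + (t + 1 : ℕ) = (j : ℤ) + d + 4 + t := by push_cast; ring
    rw [e1, e2, e3, e4]
    field_simp

theorem key_poly (p : ℝ) (j d t : ℕ) (hd : d % 2 = 1) :
    -((d : ℝ) + 2 + t) * ((j : ℝ) + 1 + Opar ((j : ℤ) - t) * (p - 2)) * aa p ((j : ℤ) - t)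
      + ((j : ℝ) + 1 + Opar ((j : ℤ) + 1 - t) * (p - 2)) * (t + 1) * bb p ((j : ℤ) + d + 3 + t)
    = bb p ((j : ℤ) + 1) * (2 * j + p + d + 1) * aa p ((j : ℤ) + 1)
      - (2 * j + p) * aa p ((j : ℤ) - t) * bb p ((j : ℤ) + d + 3 + t) := by
  have hab : bb p ((j : ℤ) + 1) * aa p ((j : ℤ) + 1) = ((j : ℝ) + 1) * (j + p - 1) := by
    rcases Int.emod_two_eq_zero_or_one ((j : ℤ) + 1) with h | h
    · rw [bb_even p h, aa_even p h]; push_cast; ring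
    · rw [bb_odd p h, aa_odd p h]; push_cast; ring
  have hab' : bb p ((j : ℤ) + 1) * (2 * j + p + d + 1) * aa p ((j : ℤ) + 1)
    = ((j : ℝ) + 1) * (j + p - 1) * (2 * j + p + d + 1) := by rw [← hab]; ring
  rw [hab']
  rcases Int.emod_two_eq_zero_or_one ((j : ℤ) - t) with h | h
  · rw [Opar_zero h, Opar_one (by omega), aa_even p h, bb_even p (by omega)]; push_cast; ring
  · rw [Opar_one h, Opar_zero (by omega), aa_odd p h, bb_odd p (by omega)]; push_cast; ring

theorem telescope (p : ℝ) (hp : 1 < p) (j d : ℕ) (hd : d % 2 = 1) (i : ℕ) :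
    ∑ t ∈ Finset.range (i + 1), (FF p (j + 1) d t *
      (bb p ((j : ℤ) + 1) * (2 * j + p + d + 1) / (bb p ((j : ℤ) + d + 2) * (2 * j + p)))
        - FF p j d t)
    = -((d : ℝ) + 1 + i) * ((j : ℝ) + 1 + Opar ((j : ℤ) + 1 - i) * (p - 2)) * FF p j d i
      / ((2 * j + p) * bb p ((j : ℤ) + d + 2 + i)) := by
  have hb : ∀ m : ℤ, 1 ≤ m → bb p m ≠ 0 := fun m hm => (bb_pos p hp m hm).ne'
  have hj : (0 : ℝ) ≤ j := Nat.cast_nonneg j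
  have hq : (2 * (j : ℝ) + p) ≠ 0 := by positivity
  have hB := hb ((j : ℤ) + d + 2) (by omega)
  induction i with
  | zero =>
    simp only [zero_add, Finset.sum_range_one, FF, PP, Finset.range_zero, Finset.prod_empty,
      Nat.choose_zero_right, Nat.cast_zero, add_zero, Nat.cast_one, mul_one, one_mul, sub_zero]
    field_simp
    rcases Int.emod_two_eq_zero_or_one ((j : ℤ)) with h | h
    · rw [Opar_one (by omega), bb_odd p (m := (j : ℤ) + 1) (by omega), bb_odd p (by omega)]
      push_cast; ring
    · rw [Opar_zero (by omega), bb_even p (m := (j : ℤ) + 1) (by omega), bb_even p (by omega)]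
      push_cast; ring
  | succ t ih =>
    rw [Finset.sum_range_succ, ih]
    have key := key_poly p j d t hd
    have h1 := hb ((j : ℤ) + d + 2 + t) (by omega)
    have h2 := hb ((j : ℤ) + d + 3 + t) (by omega)
    have ht : ((t : ℝ) + 1) ≠ 0 := by positivity
    unfold FF
    rw [PP_shift p hp, PP_succ p j d t, choose_step]
    have e1 : (j : ℤ) + 1 - (t + 1 : ℕ) = (j : ℤ) - t := by push_cast; ring
    have e3 : (j : ℤ) + d + 2 + (t + 1 : ℕ) = (j : ℤ) + d + 3 + t := by push_cast; ring
    rw [e1, e3]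
    push_cast
    generalize bb p ((j : ℤ) + d + 3 + t) = B3 at *
    generalize bb p ((j : ℤ) + d + 2 + t) = B2 at *
    generalize bb p ((j : ℤ) + d + 2) = B0 at *
    generalize bb p ((j : ℤ) + 1) = B1 at *
    generalize aa p ((j : ℤ) + 1) = A1 at *
    generalize aa p ((j : ℤ) - t) = A0 at *
    generalize (Opar ((j : ℤ) + 1 - t)) = o1 at *
    generalize (Opar ((j : ℤ) - t)) = o0 at *
    generalize PP p j d t = Q at *
    generalize (((d + t).choose t : ℕ) : ℝ) = C at *
    clear ih
    have : ∀ X Y Z W : ℝ, True := fun _ _ _ _ => trivial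
    have key2 : (-(((d:ℝ) + 2 + t) * (j + 1 + o0 * (p - 2)) * A0) - (B1 * (2 * j + p + d + 1) * A1 - (2 * j + p) * A0 * B3) + (j + 1 + o1 * (p - 2)) * (t + 1) * B3) = 0 := by linarith
    rw [← sub_eq_zero]
    have : ∀ x : ℝ, x = -(C * Q * (d + t + 1) / ((t + 1) * (2 * j + p) * B2 * B3)) * (-(((d:ℝ) + 2 + t) * (j + 1 + o0 * (p - 2)) * A0) - (B1 * (2 * j + p + d + 1) * A1 - (2 * j + p) * A0 * B3) + (j + 1 + o1 * (p - 2)) * (t + 1) * B3) → x = 0 := by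
      intro x hx; rw [hx, key2, mul_zero]
    apply this
    field_simp
    ring

theorem DD_shift (p : ℝ) (j n : ℕ) :
    DD p (j + 1) (2 * n + 1) * (2 * j + p) = DD p j (2 * n + 1) * (2 * j + p + (2 * n + 1) + 1) := by
  induction n with
  | zero =>
    have h0 : Opar ((0 : ℕ) : ℤ) = 0 := Opar_zero (by norm_num)
    have h1 : Opar ((1 : ℕ) : ℤ) = 1 := Opar_one (by norm_num)
    simp only [DD, mul_zero, zero_add, Finset.prod_range_succ, Finset.prod_range_zero, h0, h1]
    push_cast; ring
  | succ n ih =>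
    have hs : ∀ j, DD p j (2 * (n + 1) + 1) = DD p j (2 * n + 1) *
        ((2 * n + 3) * (2 * n + 2 + p + 2 * j)) := by
      intro j
      have h0 : Opar ((2 * n + 1 + 1 : ℕ) : ℤ) = 0 := Opar_zero (by omega)
      have h1 : Opar ((2 * n + 1 + 1 + 1 : ℕ) : ℤ) = 1 := Opar_one (by omega)
      unfold DD
      rw [show 2 * (n + 1) + 1 + 1 = 2 * n + 1 + 1 + 1 + 1 by ring, Finset.prod_range_succ,
        Finset.prod_range_succ, h0, h1]
      push_cast; ring
    rw [hs, hs]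
    push_cast
    linear_combination ((2 * (n : ℝ) + 3) * (2 * n + 2 + p + 2 * (j + 1))) * ih

theorem NN_shift (p : ℝ) (j d : ℕ) :
    NN p (j + 1) d * bb p ((j : ℤ) + 1) = NN p j d * bb p ((j : ℤ) + d + 2) := by
  unfold NN
  have h := Finset.prod_range_succ (fun r : ℕ => bb p ((j : ℤ) + 1 + r)) (d + 1)
  rw [Finset.prod_range_succ'] at h
  have e1 : (j : ℤ) + 1 + (d + 1 : ℕ) = (j : ℤ) + d + 2 := by push_cast; ring
  have e2 : (j : ℤ) + 1 + (0 : ℕ) = (j : ℤ) + 1 := by simp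
  rw [e1, e2] at h
  rw [← h]
  congr 1
  apply Finset.prod_congr rfl
  intro r _
  congr 1
  push_cast; ring

theorem FF_vanish (p : ℝ) (j d : ℕ) : FF p j d (j + 1) = 0 := by
  unfold FF
  rw [PP_succ, sub_self, aa_even p (by norm_num)]
  simp

theorem odd_case (p : ℝ) (hp : 1 < p) (n j : ℕ) :
    ∑ i ∈ Finset.range (j + 1), FF p j (2 * n + 1) i = NN p j (2 * n + 1) / DD p j (2 * n + 1) := by
  induction j with
  | zero =>
    have : NN p 0 (2 * n + 1) = DD p 0 (2 * n + 1) := by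
      unfold NN DD
      apply Finset.prod_congr rfl
      intro r _
      unfold bb
      rw [Opar_congr (n := (r : ℤ)) (by push_cast; omega)]
      push_cast; ring
    rw [this, div_self (DD_pos p hp _ _).ne']
    simp [FF, PP]
  | succ j ih =>
    have hj : (0 : ℝ) ≤ j := Nat.cast_nonneg j
    have hq : (2 * (j : ℝ) + p) ≠ 0 := by positivity
    have hq' : (2 * (j : ℝ) + p + (2 * n + 1) + 1) ≠ 0 := by positivity
    have h := telescope p hp j (2 * n + 1) (by omega) (j + 1)
    rw [Finset.sum_sub_distrib, ← Finset.sum_mul, FF_vanish, mul_zero, zero_div,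
      Finset.sum_range_succ (fun t => FF p j (2 * n + 1) t), FF_vanish, ih] at h
    have hB := (bb_pos p hp ((j : ℤ) + (2 * n + 1 : ℕ) + 2) (by omega)).ne'
    have hB1 := (bb_pos p hp ((j : ℤ) + 1) (by omega)).ne'
    have hD := (DD_pos p hp j (2 * n + 1)).ne'
    have hD1 := (DD_pos p hp (j + 1) (2 * n + 1)).ne'
    have hN := NN_shift p j (2 * n + 1)
    have hDs := DD_shift p j n
    rw [add_zero, sub_eq_zero] at h
    have hN' : NN p (j + 1) (2 * n + 1) =
      NN p j (2 * n + 1) * bb p ((j : ℤ) + (2 * n + 1 : ℕ) + 2) / bb p ((j : ℤ) + 1) := by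
      rw [eq_div_iff hB1, hN]
    have hD' : DD p (j + 1) (2 * n + 1) =
      DD p j (2 * n + 1) * (2 * j + p + (2 * n + 1) + 1) / (2 * j + p) := by
      rw [eq_div_iff hq, hDs]
    rw [hN', hD']
    push_cast at h hB ⊢
    field_simp at h ⊢
    linear_combination h

/-- Binomial with the very-well-poised factor. -/
theorem choose_even (d t : ℕ) :
    (Nat.choose (d + (t + 1)) (t + 1) : ℝ) * ((d + 2 * (t + 1 : ℕ) + 1) / (d + 1))
      = Nat.choose (d + 1 + (t + 1)) (t + 1) + Nat.choose (d + 1 + t) t := by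
  have h1 := Nat.add_one_mul_choose_eq (d + t) t
  have h2 := Nat.add_one_mul_choose_eq (d + t + 1) t
  have h3 : (d + 1 + t).choose t * (d + 1) = (d + (t + 1)).choose (t + 1) * (t + 1) := by
    have := Nat.choose_succ_right_eq (d + 1 + t) t
    rw [show d + 1 + t - t = d + 1 by omega] at this
    rw [← this, show d + 1 + t = d + (t + 1) by ring]
  have h4 : (d + 1 + (t + 1)).choose (t + 1) =
      (d + 1 + t).choose t + (d + (t + 1)).choose (t + 1) := by
    rw [show d + 1 + (t + 1) = (d + 1 + t) + 1 by ring, Nat.choose_succ_succ]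
    rw [show d + 1 + t = d + (t + 1) by ring]
  have h3' : ((d + 1 + t).choose t : ℝ) * (d + 1) = (d + (t + 1)).choose (t + 1) * (t + 1) := by
    exact_mod_cast h3
  rw [h4]
  push_cast
  have hd : (d : ℝ) + 1 ≠ 0 := by positivity
  field_simp
  linear_combination (-2) * h3'

theorem PP_dshift (p : ℝ) (hp : 1 < p) (j d t : ℕ) :
    PP p j d t = PP p j (d + 1) t * bb p ((j : ℤ) + d + 2 + t) / bb p ((j : ℤ) + d + 2) := by
  have hb : ∀ m : ℤ, 1 ≤ m → bb p m ≠ 0 := fun m hm => (bb_pos p hp m hm).ne'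
  have h0 := hb ((j : ℤ) + d + 2) (by omega)
  induction t with
  | zero => simp [PP, h0]
  | succ t ih =>
    have h1 := hb ((j : ℤ) + d + 2 + t) (by omega)
    have h2 := hb ((j : ℤ) + d + 3 + t) (by omega)
    rw [PP_succ, PP_succ, ih]
    have e1 : (j : ℤ) + (d + 1 : ℕ) + 2 + t = (j : ℤ) + d + 3 + t := by push_cast; ring
    have e2 : (j : ℤ) + d + 2 + (t + 1 : ℕ) = (j : ℤ) + d + 3 + t := by push_cast; ring
    rw [e1, e2]
    field_simp

theorem even_partial (p : ℝ) (hp : 1 < p) (j d : ℕ) (hd : d % 2 = 0) (i : ℕ) :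
    ∑ t ∈ Finset.range (i + 1),
      (Nat.choose (d + t) t : ℝ) * ((d + 2 * t + 1) / (d + 1)) * PP p j d t
    = (2 * j + d + p) / bb p ((j : ℤ) + d + 2) * ∑ t ∈ Finset.range (i + 1), FF p j (d + 1) t
      - FF p j (d + 1) i * aa p ((j : ℤ) - i) / bb p ((j : ℤ) + d + 2) := by
  have hb : ∀ m : ℤ, 1 ≤ m → bb p m ≠ 0 := fun m hm => (bb_pos p hp m hm).ne'
  have h0 := hb ((j : ℤ) + d + 2) (by omega)
  have hd1 : (d : ℝ) + 1 ≠ 0 := by positivity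
  have hab : ∀ t : ℕ, aa p ((j : ℤ) - t) + bb p ((j : ℤ) + d + 2 + t) = 2 * j + d + p := by
    intro t
    rcases Int.emod_two_eq_zero_or_one ((j : ℤ) - t) with h | h
    · rw [aa_even p h, bb_even p (by omega)]; push_cast; ring
    · rw [aa_odd p h, bb_odd p (by omega)]; push_cast; ring
  induction i with
  | zero =>
    have := hab 0
    simp [FF, PP] at this ⊢
    rw [div_self hd1]
    field_simp
    linarith
  | succ i ih =>
    have h2 := hb ((j : ℤ) + d + 3 + i) (by omega)
    rw [Finset.sum_range_succ, ih, Finset.sum_range_succ _ (i + 1), choose_even, PP_dshift p hp]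
    have hs := hab (i + 1)
    have e1 : (j : ℤ) + (d + 1 : ℕ) + 2 + i = (j : ℤ) + d + 3 + i := by push_cast; ring
    have e2 : (j : ℤ) + d + 2 + (i + 1 : ℕ) = (j : ℤ) + d + 3 + i := by push_cast; ring
    have hP : PP p j (d + 1) (i + 1) * bb p ((j : ℤ) + d + 3 + i)
        = PP p j (d + 1) i * aa p ((j : ℤ) - i) := by
      rw [PP_succ, e1]; field_simp
    rw [e2] at hs ⊢
    unfold FF
    rw [← hs]
    field_simp
    linear_combination ((d + 1 + i).choose i : ℝ) * hP

theorem even_case (p : ℝ) (hp : 1 < p) (n j : ℕ) :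
    ∑ t ∈ Finset.range (j + 1),
      (Nat.choose (2 * n + t) t : ℝ) * (((2 * n : ℕ) + 2 * t + 1) / ((2 * n : ℕ) + 1))
        * PP p j (2 * n) t
    = NN p j (2 * n) / DD p j (2 * n) := by
  rw [even_partial p hp j (2 * n) (by omega) j, odd_case p hp, sub_self, aa_even p (by norm_num)]
  have hB := (bb_pos p hp ((j : ℤ) + (2 * n : ℕ) + 2) (by omega)).ne'
  have hD := (DD_pos p hp j (2 * n)).ne'
  have hj : (0 : ℝ) ≤ j := Nat.cast_nonneg j
  have hq : (2 * (j : ℝ) + (2 * n : ℕ) + p) ≠ 0 := by positivity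
  have e1 : NN p j (2 * n + 1) = NN p j (2 * n) * bb p ((j : ℤ) + (2 * n : ℕ) + 2) := by
    unfold NN
    rw [Finset.prod_range_succ _ (2 * n + 1)]
    congr 2; push_cast; ring
  have e2 : DD p j (2 * n + 1) = DD p j (2 * n) * (2 * (j : ℝ) + (2 * n : ℕ) + p) := by
    unfold DD
    rw [Finset.prod_range_succ _ (2 * n + 1), Opar_one (m := ((2 * n + 1 : ℕ) : ℤ)) (by omega)]
    congr 1; push_cast; ring
  rw [e1, e2]
  simp only [Int.cast_zero, mul_zero, zero_div, sub_zero]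
  field_simp

theorem rhs_eq (p : ℝ) (j d : ℕ) :
    ∏ r ∈ Finset.range (d + 1),
        (((j + d : ℕ) : ℝ) + 1 - r + Opar (((j + d : ℕ) : ℤ) - r) * (p - 2))
         / ((r : ℝ) + 1 + Opar (r : ℤ) * (p - 2 + 2 * j)) = NN p j d / DD p j d := by
  rw [Finset.prod_div_distrib]
  unfold NN DD
  congr 1
  rw [← Finset.prod_range_reflect]
  apply Finset.prod_congr rfl
  intro r hr
  have hr' : r ≤ d := by have := Finset.mem_range.mp hr; omega
  have e : d + 1 - 1 - r = d - r := by omega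
  rw [e]
  unfold bb
  rw [Opar_congr (m := (j : ℤ) + 1 + r + 1) (n := ((j + d : ℕ) : ℤ) - ((d - r : ℕ) : ℤ)) (by omega)]
  push_cast [Nat.cast_sub hr']
  ring

theorem prod_eq (p : ℝ) (j d i : ℕ) (hdd : d % 2 = 1) :
    ∏ r ∈ Finset.Icc 1 i,
          (((j : ℝ) + 1 - r + Epar ((j : ℤ) - r) * (p - 2)) *
              (((j + d : ℕ) : ℝ) - j + 2 * r + Opar (((j + d : ℕ) : ℤ) + j - 1)))
           / ((((j + d : ℕ) : ℝ) + 1 + r + Epar (((j + d : ℕ) : ℤ) + r - 1) * (p - 2)) *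
              (((j + d : ℕ) : ℝ) - j + 2 * r - Opar (((j + d : ℕ) : ℤ) + j - 1)))
     = PP p j d i := by
  induction i with
  | zero => simp [PP]
  | succ i ih =>
    rw [Finset.prod_Icc_succ_top (by omega), ih, PP_succ]
    congr 1
    rw [Opar_zero (m := ((j + d : ℕ) : ℤ) + j - 1) (by omega), Epar_eq, Epar_eq]
    unfold aa bb
    rw [Opar_congr (m := (j : ℤ) - (i + 1 : ℕ) + 1) (n := (j : ℤ) - i) (by omega),
      Opar_congr (m := ((j + d : ℕ) : ℤ) + (i + 1 : ℕ) - 1 + 1) (n := (j : ℤ) + d + 2 + i + 1)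
        (by omega), add_zero, sub_zero, mul_div_mul_right]
    · push_cast
      congr 1 <;> ring
    · push_cast
      have : (0 : ℝ) < (j : ℝ) + d - j + 2 * (i + 1) := by
        have : (0 : ℝ) ≤ d := Nat.cast_nonneg d
        have : (0 : ℝ) ≤ i := Nat.cast_nonneg i
        linarith
      exact this.ne'

theorem prod_eq_even (p : ℝ) (j d i : ℕ) (hdd : d % 2 = 0) :
    ∏ r ∈ Finset.Icc 1 i,
          (((j : ℝ) + 1 - r + Epar ((j : ℤ) - r) * (p - 2)) *
              (((j + d : ℕ) : ℝ) - j + 2 * r + Opar (((j + d : ℕ) : ℤ) + j - 1)))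
           / ((((j + d : ℕ) : ℝ) + 1 + r + Epar (((j + d : ℕ) : ℤ) + r - 1) * (p - 2)) *
              (((j + d : ℕ) : ℝ) - j + 2 * r - Opar (((j + d : ℕ) : ℤ) + j - 1)))
     = (((d : ℝ) + 2 * i + 1) / (d + 1)) * PP p j d i := by
  have hd1 : (d : ℝ) + 1 ≠ 0 := by positivity
  induction i with
  | zero => simp [PP, hd1]
  | succ i ih =>
    rw [Finset.prod_Icc_succ_top (by omega), ih, PP_succ]
    rw [Opar_one (m := ((j + d : ℕ) : ℤ) + j - 1) (by omega), Epar_eq, Epar_eq, mul_div_mul_comm]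
    have ea : (j : ℝ) + 1 - (i + 1 : ℕ) + Opar ((j : ℤ) - (i + 1 : ℕ) + 1) * (p - 2)
        = aa p ((j : ℤ) - i) := by
      unfold aa
      rw [Opar_congr (m := (j : ℤ) - (i + 1 : ℕ) + 1) (n := (j : ℤ) - i) (by omega)]
      push_cast; ring
    have eb : ((j + d : ℕ) : ℝ) + 1 + (i + 1 : ℕ)
        + Opar (((j + d : ℕ) : ℤ) + (i + 1 : ℕ) - 1 + 1) * (p - 2)
        = bb p ((j : ℤ) + d + 2 + i) := by
      unfold bb
      rw [Opar_congr (m := ((j + d : ℕ) : ℤ) + (i + 1 : ℕ) - 1 + 1) (n := (j : ℤ) + d + 2 + i + 1)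
        (by omega)]
      push_cast; ring
    have ec : ((j + d : ℕ) : ℝ) - j + 2 * (i + 1 : ℕ) - 1 = (d : ℝ) + 2 * i + 1 := by
      push_cast; ring
    have ed : ((j + d : ℕ) : ℝ) - j + 2 * (i + 1 : ℕ) + 1 = (d : ℝ) + 2 * (i + 1 : ℕ) + 1 := by
      push_cast; ring
    rw [ea, eb, ec, ed]
    have : (d : ℝ) + 2 * i + 1 ≠ 0 := by positivity
    generalize aa p ((j : ℤ) - i) / bb p ((j : ℤ) + d + 2 + i) = X
    field_simp

theorem stmt4 (p : ℝ) (hp : 1 < p) (j k : ℕ) (hjk : j ≤ k) :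
    ∑ i ∈ Finset.range (j + 1),
      (Nat.choose (k - j + i) i : ℝ) *
        ∏ r ∈ Finset.Icc 1 i,
          (((j : ℝ) + 1 - r + Epar ((j : ℤ) - r) * (p - 2)) *
              ((k : ℝ) - j + 2 * r + Opar ((k : ℤ) + j - 1)))
           / (((k : ℝ) + 1 + r + Epar ((k : ℤ) + r - 1) * (p - 2)) *
              ((k : ℝ) - j + 2 * r - Opar ((k : ℤ) + j - 1)))
    = ∏ r ∈ Finset.range (k - j + 1),
        ((k : ℝ) + 1 - r + Opar ((k : ℤ) - r) * (p - 2))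
         / ((r : ℝ) + 1 + Opar (r : ℤ) * (p - 2 + 2 * j)) := by
  obtain ⟨d, rfl⟩ := Nat.exists_eq_add_of_le hjk
  rw [show j + d - j = d by omega, rhs_eq]
  rcases Nat.mod_two_eq_zero_or_one d with h | h
  · obtain ⟨n, rfl⟩ : ∃ n, d = 2 * n := ⟨d / 2, by omega⟩
    rw [← even_case p hp]
    apply Finset.sum_congr rfl
    intro i _
    rw [prod_eq_even p j (2 * n) i h, mul_assoc]
  · obtain ⟨n, rfl⟩ : ∃ n, d = 2 * n + 1 := ⟨d / 2, by omega⟩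
    rw [← odd_case p hp]
    apply Finset.sum_congr rfl
    intro i _
    rw [prod_eq p j (2 * n + 1) i h, FF]
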